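/- For every C' > 0 there exists C > 0 such that for all v ≥ 1, η ∈ (0,1] and M ≥ 0: ∫_0^∞ ( e^{−v²/(16 s)} + e^{−v/2} ) / ( √s (s+1) ) · ( 1_{s ∉ [η v², η^{−1} v²]} + e^{−C' M} 1_{s ∈ [η v², η^{−1} v²]} ) ds ≤ C ( e^{−v/2} + 1/v + e^{−C' M}/(v √η) + √η / v ). In particular the proof uses: ∫_0^∞ ds/(√s (s+1)) is finite, ∫_0^{η v²} s^{−3/2} e^{−v²/(16 s)} ds ≤ ∫_0^∞ s^{−3/2} e^{−v²/(16 s)} ds = 4√π / v, and ∫_a^∞ s^{−3/2} ds = 2/√a for a > 0, applied with a = η v² and a = η^{−1} v². -/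

import Mathlib

open MeasureTheory Filter Set
open scoped ENNReal Classical

/-- Substituting `y = s ^ (1/2)` in `∫ 1 / (1 + y²)`. -/
theorem integrableOn_one_div_sqrt_mul_add_one :
    IntegrableOn (fun s : ℝ => 1 / (Real.sqrt s * (s + 1))) (Ioi 0) := by
  have h := (integrableOn_Ioi_comp_rpow_iff' (fun y : ℝ => (1 + y ^ 2)⁻¹)
    (p := 1 / 2) (by norm_num)).2 integrable_inv_one_add_sq.integrableOn
  refine h.congr_fun (fun s hs => ?_) measurableSet_Ioi
  have hs0 : (0 : ℝ) < s := hs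
  have hq : 0 < Real.sqrt s := Real.sqrt_pos.2 hs0
  have e1 : s ^ ((1 : ℝ) / 2 - 1) = (Real.sqrt s)⁻¹ := by
    rw [show (1 : ℝ) / 2 - 1 = -(1 / 2) by norm_num, Real.rpow_neg hs0.le,
      ← Real.sqrt_eq_rpow]
  simp only [smul_eq_mul]
  rw [e1, ← Real.sqrt_eq_rpow, Real.sq_sqrt hs0.le]
  field_simp
  ring

theorem lintegral_one_div_sqrt_mul_add_one_lt_top :
    (∫⁻ s in Ioi (0 : ℝ), ENNReal.ofReal (1 / (Real.sqrt s * (s + 1)))) < ⊤ :=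
  integrableOn_one_div_sqrt_mul_add_one.lintegral_lt_top

/-- Substituting `y = s ^ (-1/2)` in the Gaussian integral. -/
theorem lintegral_rpow_mul_exp_neg_div {v : ℝ} (hv : 0 < v) :
    (∫⁻ s in Ioi (0 : ℝ),
        ENNReal.ofReal (s ^ (-(3 : ℝ) / 2) * Real.exp (-(v ^ 2 / (16 * s)))))
      = ENNReal.ofReal (4 * Real.sqrt Real.pi / v) := by
  set g : ℝ → ℝ := fun y => Real.exp (-(v ^ 2 / 16) * y ^ 2)
  have hp : (-(1 : ℝ) / 2) ≠ 0 := by norm_num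
  have hb : 0 < v ^ 2 / 16 := by positivity
  have hi := (integrableOn_Ioi_comp_rpow_iff' g hp).2 (integrable_exp_neg_mul_sq hb).integrableOn
  have hint := integral_comp_rpow_Ioi g hp
  have hpt : ∀ s ∈ Ioi (0 : ℝ), s ^ (-(1 : ℝ) / 2 - 1) * g (s ^ (-(1 : ℝ) / 2))
      = s ^ (-(3 : ℝ) / 2) * Real.exp (-(v ^ 2 / (16 * s))) := by
    intro s hs
    have hs0 : (0 : ℝ) < s := hs
    have e : (s ^ (-(1 : ℝ) / 2)) ^ 2 = s⁻¹ := by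
      rw [← Real.rpow_natCast, ← Real.rpow_mul hs0.le, ← Real.rpow_neg_one]
      norm_num
    simp only [g]
    rw [e, show (-(1 : ℝ) / 2 - 1) = -(3 : ℝ) / 2 by norm_num]
    congr 2
    field_simp
  have hi' := hi.congr_fun (fun s hs => by simpa only [smul_eq_mul] using hpt s hs)
    measurableSet_Ioi
  have habs : |(-(1 : ℝ) / 2)| = 1 / 2 := by rw [abs_of_neg] <;> norm_num
  have hval : ∫ s in Ioi (0 : ℝ), s ^ (-(3 : ℝ) / 2) * Real.exp (-(v ^ 2 / (16 * s)))
      = 4 * Real.sqrt Real.pi / v := by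
    simp only [smul_eq_mul, habs, mul_assoc] at hint
    rw [integral_const_mul, setIntegral_congr_fun measurableSet_Ioi hpt,
      integral_gaussian_Ioi, show Real.pi / (v ^ 2 / 16) = Real.pi * (4 / v) ^ 2 by
        field_simp; norm_num, Real.sqrt_mul Real.pi_pos.le,
      Real.sqrt_sq (by positivity)] at hint
    linear_combination 2 * hint
  rw [← hval, ofReal_integral_eq_lintegral_ofReal hi']
  refine (ae_restrict_iff' measurableSet_Ioi).2 (.of_forall fun s hs => ?_)
  have hs0 : (0 : ℝ) < s := hs
  show 0 ≤ _
  positivity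

theorem lintegral_Ioi_rpow_neg_three_halves {a : ℝ} (ha : 0 < a) :
    (∫⁻ s in Ioi a, ENNReal.ofReal (s ^ (-(3 : ℝ) / 2)))
      = ENNReal.ofReal (2 / Real.sqrt a) := by
  have h32 : -(3 : ℝ) / 2 < -1 := by norm_num
  rw [← ofReal_integral_eq_lintegral_ofReal (integrableOn_Ioi_rpow_of_lt h32 ha),
    integral_Ioi_rpow_of_lt h32 ha, show -(3 : ℝ) / 2 + 1 = -(1 / 2) by norm_num,
    Real.rpow_neg ha.le, ← Real.sqrt_eq_rpow]
  · congr 1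
    field_simp
  · refine (ae_restrict_iff' measurableSet_Ioi).2 (.of_forall fun s hs => ?_)
    exact Real.rpow_nonneg (ha.trans hs).le _

/-- Pointwise bound on the integrand, for a weight `w ≤ 1`. -/
theorem add_div_sqrt_mul_add_one_mul_le {s A B w : ℝ} (hs : 0 < s) (hA : 0 ≤ A) (hB : 0 ≤ B)
    (hw : w ≤ 1) :
    (A + B) / (Real.sqrt s * (s + 1)) * w
      ≤ s ^ (-(3 : ℝ) / 2) * A + B * (1 / (Real.sqrt s * (s + 1))) := by
  have hq : 0 < Real.sqrt s := Real.sqrt_pos.2 hs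
  have e : s ^ (-(3 : ℝ) / 2) = 1 / (Real.sqrt s * s) := by
    rw [show -(3 : ℝ) / 2 = -(1 / 2 + 1) by norm_num, Real.rpow_neg hs.le,
      Real.rpow_add hs, Real.rpow_one, ← Real.sqrt_eq_rpow, one_div]
  calc (A + B) / (Real.sqrt s * (s + 1)) * w
      ≤ (A + B) / (Real.sqrt s * (s + 1)) := mul_le_of_le_one_right (by positivity) hw
    _ = 1 / (Real.sqrt s * (s + 1)) * A + B * (1 / (Real.sqrt s * (s + 1))) := by ring
    _ ≤ _ := by
      rw [e]
      gcongr
      linarith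

/-- For every `C' > 0` there exists `C > 0` such that for all `v ≥ 1`,
`η ∈ (0,1]` and `M ≥ 0`:
`∫_0^∞ (e^{−v²/(16s)} + e^{−v/2}) / (√s (s+1)) ·
   ( 1_{s ∉ [ηv², η⁻¹v²]} + e^{−C'M} 1_{s ∈ [ηv², η⁻¹v²]} ) ds
   ≤ C ( e^{−v/2} + 1/v + e^{−C'M}/(v√η) + √η/v )`.
In particular (facts used in the proof): `∫_0^∞ ds/(√s (s+1)) < ∞`,
`∫_0^∞ s^{−3/2} e^{−v²/(16s)} ds = 4√π/v` for `v ≥ 1`, and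
`∫_a^∞ s^{−3/2} ds = 2/√a` for `a > 0`. -/
theorem repulsion_integral_estimate :
    (∀ C' > (0 : ℝ), ∃ C > (0 : ℝ), ∀ v ≥ (1 : ℝ), ∀ η : ℝ, 0 < η → η ≤ 1 →
      ∀ M ≥ (0 : ℝ),
      (∫⁻ s in Ioi (0 : ℝ), ENNReal.ofReal
          (((Real.exp (-(v ^ 2 / (16 * s))) + Real.exp (-(v / 2)))
              / (Real.sqrt s * (s + 1)))
            * (if s ∈ Icc (η * v ^ 2) (v ^ 2 / η) then Real.exp (-(C' * M)) else 1)))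
        ≤ ENNReal.ofReal (C * (Real.exp (-(v / 2)) + 1 / v
            + Real.exp (-(C' * M)) / (v * Real.sqrt η) + Real.sqrt η / v)))
    ∧
    (∫⁻ s in Ioi (0 : ℝ), ENNReal.ofReal (1 / (Real.sqrt s * (s + 1)))) < ⊤
    ∧
    (∀ v ≥ (1 : ℝ),
      (∫⁻ s in Ioi (0 : ℝ),
          ENNReal.ofReal (s ^ (-(3 : ℝ) / 2) * Real.exp (-(v ^ 2 / (16 * s)))))
        = ENNReal.ofReal (4 * Real.sqrt Real.pi / v))
    ∧
    (∀ a > (0 : ℝ),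
      (∫⁻ s in Ioi a, ENNReal.ofReal (s ^ (-(3 : ℝ) / 2)))
        = ENNReal.ofReal (2 / Real.sqrt a)) := by
  refine ⟨fun C' hC' => ?_, lintegral_one_div_sqrt_mul_add_one_lt_top,
    fun v hv => lintegral_rpow_mul_exp_neg_div (by linarith),
    fun a ha => lintegral_Ioi_rpow_neg_three_halves ha⟩
  set K : ℝ := (∫⁻ s in Ioi (0 : ℝ), ENNReal.ofReal (1 / (Real.sqrt s * (s + 1)))).toReal with hK
  have hK0 : 0 ≤ K := ENNReal.toReal_nonneg
  refine ⟨4 * Real.sqrt Real.pi + K, by positivity, fun v hv η hη _ M hM => ?_⟩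
  have hv0 : 0 < v := by linarith
  have hw : Real.exp (-(C' * M)) ≤ 1 := Real.exp_le_one_iff.2 (by
    have := mul_nonneg hC'.le hM
    linarith)
  calc _ ≤ ∫⁻ s in Ioi (0 : ℝ),
        (ENNReal.ofReal (s ^ (-(3 : ℝ) / 2) * Real.exp (-(v ^ 2 / (16 * s))))
          + ENNReal.ofReal (Real.exp (-(v / 2)))
            * ENNReal.ofReal (1 / (Real.sqrt s * (s + 1)))) := by
        refine setLIntegral_mono' measurableSet_Ioi fun s hs => ?_
        have hs0 : (0 : ℝ) < s := hs
        rw [← ENNReal.ofReal_mul (Real.exp_pos _).le,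
          ← ENNReal.ofReal_add (by positivity) (by positivity)]
        refine ENNReal.ofReal_le_ofReal (add_div_sqrt_mul_add_one_mul_le hs0
          (Real.exp_pos _).le (Real.exp_pos _).le ?_)
        split_ifs
        exacts [hw, le_rfl]
    _ = ENNReal.ofReal (4 * Real.sqrt Real.pi / v + Real.exp (-(v / 2)) * K) := by
        rw [lintegral_add_left (by fun_prop), lintegral_rpow_mul_exp_neg_div hv0,
          lintegral_const_mul _ (by fun_prop), ENNReal.ofReal_add (by positivity) (by positivity),
          ENNReal.ofReal_mul (Real.exp_pos _).le, hK,
          ENNReal.ofReal_toReal lintegral_one_div_sqrt_mul_add_one_lt_top.ne]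
    _ ≤ _ := by
        refine ENNReal.ofReal_le_ofReal ?_
        have hE : 0 < Real.exp (-(v / 2)) := Real.exp_pos _
        have h1 : 0 ≤ 4 * Real.sqrt Real.pi * (Real.exp (-(v / 2))
            + Real.exp (-(C' * M)) / (v * Real.sqrt η) + Real.sqrt η / v) := by positivity
        have h2 : 0 ≤ K * (1 / v
            + Real.exp (-(C' * M)) / (v * Real.sqrt η) + Real.sqrt η / v) := by positivity
        linear_combination h1 + h2
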